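/- Let f̂_n be any estimator satisfying the PAC-Bayesian bound E(‖f̂_n − f‖_n²) ≤ ∫ ‖f_λ − f‖_n² p(dλ) + β 𝒦(p, π)/n for all p ∈ 𝒫_Λ, with the sparsity prior π(dλ) = q(λ)dλ, where τ ≤ δ L₀/√M for some 0 < L₀ ≤ ∞ and 0 < δ < 1, and assume Λ ⊆ ℝ^M contains the Euclidean ball {λ : ‖λ‖ ≤ L₀}. Then for all λ* with ‖λ*‖ ≤ (1 − δ)L₀, E( ‖f̂_n − f‖_n² ) ≤ ‖f_{λ*} − f‖_n² + (4β/n) Σ_{j ∈ J(λ*)} log(1 + τ^{-1}|λ*_j|) + R(M, τ, L₀, δ), where R(M, τ, L₀, δ) = τ² e^{2τ³ M^{5/2} (δL₀)^{-3}} Σ_{j=1}^M ‖φ_j‖_n² + 2βτ³ M^{5/2} / (n δ³ L₀³) for L₀ < ∞, and R(M, τ, ∞, δ) = τ² Σ_{j=1}^M ‖φ_j‖_n². -/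

import Mathlib

open MeasureTheory ProbabilityTheory
open scoped ENNReal NNReal

noncomputable section

/-- Empirical squared norm `‖v‖ₙ² = n⁻¹ ∑ᵢ vᵢ²`. -/
def normSqV (n : ℕ) (v : Fin n → ℝ) : ℝ := (∑ i, v i ^ 2) / n

/-- Exponential weight `θ_λ(Y)`. -/
def expWeight {X Λ : Type*} [MeasurableSpace Λ] (n : ℕ) (x : Fin n → X)
    (F : Λ → X → ℝ) (π : Measure Λ) (β : ℝ) (Y : Fin n → ℝ) (l : Λ) : ℝ :=
  Real.exp (-(n : ℝ) * normSqV n (fun i => Y i - F l (x i)) / β) /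
    ∫ w, Real.exp (-(n : ℝ) * normSqV n (fun i => Y i - F w (x i)) / β) ∂π

/-- Exponentially weighted aggregate `f̂ₙ` evaluated at a point. -/
def aggregate {X Λ : Type*} [MeasurableSpace Λ] (n : ℕ) (x : Fin n → X)
    (F : Λ → X → ℝ) (π : Measure Λ) (β : ℝ) (Y : Fin n → ℝ) (pt : X) : ℝ :=
  ∫ l, expWeight n x F π β Y l * F l pt ∂π

open Classical in
/-- Kullback–Leibler divergence `𝒦(p,π)`, equal to `⊤` when undefined. -/
def klDiv {α : Type*} [MeasurableSpace α] (p q : Measure α) : EReal :=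
  if p ≪ q ∧ Integrable (fun a => Real.log (p.rnDeriv q a).toReal) p
  then ((∫ a, Real.log (p.rnDeriv q a).toReal ∂p : ℝ) : EReal)
  else ⊤

/-- The density `q₀(t) = 3/(2(1+|t|)⁴)`. -/
def q0 (t : ℝ) : ℝ := 3 / (2 * (1 + |t|) ^ 4)

open Classical in
/-- Unnormalized sparsity prior density
`λ ↦ ∏ⱼ τ⁻¹ q₀(λⱼ/τ) · 1(‖λ‖ ≤ L₀)` on `ℝ^M` (Euclidean norm). -/
def sparsityDensity (M : ℕ) (τ : ℝ) (L₀ : ℝ≥0∞) (l : EuclideanSpace ℝ (Fin M)) : ℝ :=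
  (∏ j, τ⁻¹ * q0 (l j / τ)) * (if ENNReal.ofReal ‖l‖ ≤ L₀ then 1 else 0)

/-- The sparsity prior `π(dλ) = q(λ)dλ` with normalizing constant `C₀`. -/
def sparsityPrior (M : ℕ) (τ : ℝ) (L₀ : ℝ≥0∞) : Measure (EuclideanSpace ℝ (Fin M)) :=
  MeasureTheory.volume.withDensity fun l =>
    ENNReal.ofReal ((∫ l', sparsityDensity M τ L₀ l')⁻¹ * sparsityDensity M τ L₀ l)


lemma q0_pos (t : ℝ) : 0 < q0 t := by unfold q0; positivity

lemma q0_cont : Continuous q0 := by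
  unfold q0
  refine Continuous.div (by fun_prop) (by fun_prop) (fun t => by positivity)

lemma hasDerivAt_cube (t : ℝ) : HasDerivAt (fun t : ℝ => (1 + t) ^ 3) (3 * (1 + t) ^ 2) t := by
  have h := (hasDerivAt_id t).const_add 1
  have h2 := h.fun_pow 3
  refine h2.congr_deriv ?_
  simp

lemma q0_integral : ∫ t, q0 t = 1 := by
  have h := integral_comp_abs (f := fun s => 3 / (2 * (1 + s) ^ 4))
  have h2 : ∫ t in Set.Ioi (0:ℝ), 3 / (2 * (1 + t) ^ 4)
      = 0 - (fun t : ℝ => -(1/2) * ((1 + t) ^ 3)⁻¹) 0 := by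
    refine integral_Ioi_of_hasDerivAt_of_nonneg' (g := fun t : ℝ => -(1/2) * ((1 + t) ^ 3)⁻¹)
      (g' := fun t : ℝ => 3 / (2 * (1 + t) ^ 4)) ?_ ?_ ?_
    · intro t ht
      have ht : (0:ℝ) ≤ t := ht
      have h1 := hasDerivAt_cube t
      have h3 := (h1.fun_inv (by positivity)).const_mul (-(1/2 : ℝ))
      refine h3.congr_deriv ?_
      field_simp
    · intro t ht
      have ht : (0:ℝ) < t := ht
      positivity
    · have : Filter.Tendsto (fun t : ℝ => (1 + t) ^ 3) Filter.atTop Filter.atTop :=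
        (Filter.tendsto_pow_atTop (by norm_num)).comp
          (Filter.tendsto_atTop_add_const_left _ 1 Filter.tendsto_id)
      have := (tendsto_inv_atTop_zero.comp this).const_mul (-(1/2 : ℝ))
      simpa using this
  have h' : ∫ t, q0 t = 2 * ∫ t in Set.Ioi (0:ℝ), 3 / (2 * (1 + t) ^ 4) := h
  rw [h', h2]; norm_num

lemma q0_second : ∫ t, t ^ 2 * q0 t = 1 := by
  have h := integral_comp_abs (f := fun s => s ^ 2 * (3 / (2 * (1 + s) ^ 4)))
  have h2 : ∫ t in Set.Ioi (0:ℝ), t ^ 2 * (3 / (2 * (1 + t) ^ 4))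
      = (1/2) * (1 - 0) ^ 3 - (fun t : ℝ => (1/2) * (1 - (1 + t)⁻¹) ^ 3) 0 := by
    refine integral_Ioi_of_hasDerivAt_of_nonneg' (g := fun t : ℝ => (1/2) * (1 - (1 + t)⁻¹) ^ 3)
      (g' := fun t : ℝ => t ^ 2 * (3 / (2 * (1 + t) ^ 4))) ?_ ?_ ?_
    · intro t ht
      have ht : (0:ℝ) ≤ t := ht
      have h0 : (1 + t) ≠ 0 := by positivity
      have h1 : HasDerivAt (fun t : ℝ => (1 - (1 + t)⁻¹)) (((1 + t) ^ 2)⁻¹) t := by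
        have := (((hasDerivAt_id t).const_add 1).inv h0).const_sub 1
        refine this.congr_deriv ?_
        simp [neg_div]
      have h3 := (h1.fun_pow 3).const_mul (1/2 : ℝ)
      refine h3.congr_deriv ?_
      have h5 : 1 - (1 + t)⁻¹ = t / (1 + t) := by field_simp; ring
      rw [h5]
      norm_num
      field_simp
    · intro t ht
      have ht : (0:ℝ) < t := ht
      positivity
    · have : Filter.Tendsto (fun t : ℝ => (1 + t)) Filter.atTop Filter.atTop :=
          (Filter.tendsto_atTop_add_const_left _ 1 Filter.tendsto_id)
      exact (((tendsto_inv_atTop_zero.comp this).const_sub 1).pow 3).const_mul (1/2 : ℝ)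
  have h' : ∫ t, t ^ 2 * q0 t = 2 * ∫ t in Set.Ioi (0:ℝ), t ^ 2 * (3 / (2 * (1 + t) ^ 4)) := by
    rw [← h]; simp [q0]
  rw [h', h2]; norm_num

lemma q0_cut (a : ℝ) (ha : 0 ≤ a) :
    ∫ t, (if |t| ≤ a then q0 t else 0) = 1 - ((1 + a) ^ 3)⁻¹ := by
  have h := integral_comp_abs (f := fun s => if s ≤ a then 3 / (2 * (1 + s) ^ 4) else 0)
  have e : (fun s : ℝ => if s ≤ a then 3 / (2 * (1 + s) ^ 4) else 0)
      = Set.indicator (Set.Iic a) (fun s => 3 / (2 * (1 + s) ^ 4)) := by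
    ext s; simp [Set.indicator_apply]
  have h' : ∫ t, (if |t| ≤ a then q0 t else 0)
      = 2 * ∫ t in Set.Ioi (0:ℝ), (if t ≤ a then 3 / (2 * (1 + t) ^ 4) else 0) := h
  rw [h', e, setIntegral_indicator measurableSet_Iic, Set.Ioi_inter_Iic,
    ← intervalIntegral.integral_of_le ha]
  rw [intervalIntegral.integral_eq_sub_of_hasDerivAt
    (f := fun t : ℝ => -(1/2) * ((1 + t) ^ 3)⁻¹)]
  · norm_num; ring
  · intro t ht
    rw [Set.uIcc_of_le ha] at ht
    have ht : (0:ℝ) ≤ t := ht.1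
    have h1 := hasDerivAt_cube t
    have h3 := (h1.fun_inv (by positivity)).const_mul (-(1/2 : ℝ))
    refine h3.congr_deriv ?_
    field_simp
  · apply ContinuousOn.intervalIntegrable
    rw [Set.uIcc_of_le ha]
    refine ContinuousOn.div (by fun_prop) (by fun_prop) (fun t ht => ?_)
    have ht : (0:ℝ) ≤ t := ht.1
    positivity

lemma d_integral (τ : ℝ) (hτ : 0 < τ) : ∫ t, τ⁻¹ * q0 (t / τ) = 1 := by
  rw [integral_const_mul, Measure.integral_comp_div, q0_integral, abs_of_pos hτ]
  simp [hτ.ne']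

lemma d_second (τ : ℝ) (hτ : 0 < τ) : ∫ t, t ^ 2 * (τ⁻¹ * q0 (t / τ)) = τ ^ 2 := by
  have e : (fun t => t ^ 2 * (τ⁻¹ * q0 (t / τ)))
      = fun t => (fun s => τ * (s ^ 2 * q0 s)) (t / τ) := by
    ext t; field_simp
  rw [e, Measure.integral_comp_div (fun s => τ * (s ^ 2 * q0 s)), integral_const_mul, q0_second, abs_of_pos hτ]
  simp [pow_two]

lemma d_cut (τ : ℝ) (hτ : 0 < τ) (a : ℝ) (ha : 0 ≤ a) :
    ∫ t, (if |t| ≤ a * τ then τ⁻¹ * q0 (t / τ) else 0) = 1 - ((1 + a) ^ 3)⁻¹ := by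
  have e : (fun t => (if |t| ≤ a * τ then τ⁻¹ * q0 (t / τ) else 0))
      = fun t => (fun s => τ⁻¹ * (if |s| ≤ a then q0 s else 0)) (t / τ) := by
    ext t
    have : |t / τ| ≤ a ↔ |t| ≤ a * τ := by
      rw [abs_div, abs_of_pos hτ, div_le_iff₀ hτ]
    simp [this]
  rw [e, Measure.integral_comp_div (fun s => τ⁻¹ * (if |s| ≤ a then q0 s else 0)), integral_const_mul, q0_cut a ha, abs_of_pos hτ]
  simp [hτ.ne']

lemma eucl_prod_integral (M : ℕ) (h : Fin M → ℝ → ℝ) :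
    ∫ l : EuclideanSpace ℝ (Fin M), ∏ j, h j (l j) = ∏ j, ∫ t, h j t := by
  rw [← integral_fintype_prod_volume_eq_prod,
    ← (EuclideanSpace.volume_preserving_symm_measurableEquiv_toLp (Fin M)).integral_comp
      (MeasurableEquiv.measurableEmbedding _)]
  rfl

lemma eucl_prod_integrable (M : ℕ) (h : Fin M → ℝ → ℝ) (hh : ∀ j, Integrable (h j)) :
    Integrable (fun l : EuclideanSpace ℝ (Fin M) => ∏ j, h j (l j)) := by
  have := Integrable.fintype_prod (μ := fun _ => volume) hh
  exact (EuclideanSpace.volume_preserving_symm_measurableEquiv_toLp (Fin M)).integrable_comp_of_integrable this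

/-- product density -/
def gd (M : ℕ) (τ : ℝ) (l : EuclideanSpace ℝ (Fin M)) : ℝ := ∏ j, τ⁻¹ * q0 (l j / τ)

lemma gd_pos (M : ℕ) (τ : ℝ) (hτ : 0 < τ) (l) : 0 < gd M τ l :=
  Finset.prod_pos fun _ _ => mul_pos (inv_pos.2 hτ) (q0_pos _)

lemma gd_cont (M : ℕ) (τ : ℝ) : Continuous (gd M τ) := by
  unfold gd
  have := q0_cont
  fun_prop

lemma gd_integral (M : ℕ) (τ : ℝ) (hτ : 0 < τ) : ∫ l, gd M τ l = 1 := by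
  unfold gd
  rw [eucl_prod_integral M (fun _ t => τ⁻¹ * q0 (t / τ))]
  simp [d_integral τ hτ]

lemma gd_integrable (M : ℕ) (τ : ℝ) (hτ : 0 < τ) : Integrable (gd M τ) :=
  .of_integral_ne_zero (by rw [gd_integral M τ hτ]; norm_num)

lemma gd_second (M : ℕ) (τ : ℝ) (hτ : 0 < τ) (k : Fin M) :
    ∫ l, l k ^ 2 * gd M τ l = τ ^ 2 := by
  have e : (fun l : EuclideanSpace ℝ (Fin M) => l k ^ 2 * gd M τ l)
      = fun l => ∏ j, (fun j t => (if j = k then t ^ 2 * (τ⁻¹ * q0 (t / τ))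
          else τ⁻¹ * q0 (t / τ))) j (l j) := by
    ext l
    unfold gd
    rw [← Finset.mul_prod_erase _ _ (Finset.mem_univ k),
      ← Finset.mul_prod_erase _ (fun j => (fun j t => (if j = k then t ^ 2 * (τ⁻¹ * q0 (t / τ))
          else τ⁻¹ * q0 (t / τ))) j (l j)) (Finset.mem_univ k), ← mul_assoc]
    simp only [if_true]
    congr 1
    apply Finset.prod_congr rfl
    intro j hj
    simp [Finset.ne_of_mem_erase hj]
  rw [e, eucl_prod_integral M (fun j t => (if j = k then t ^ 2 * (τ⁻¹ * q0 (t / τ))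
          else τ⁻¹ * q0 (t / τ)))]
  rw [Finset.prod_eq_single k]
  · simp [d_second τ hτ]
  · intro j _ hj
    simp [hj, d_integral τ hτ]
  · simp

lemma gd_second_integrable (M : ℕ) (τ : ℝ) (hτ : 0 < τ) (k : Fin M) :
    Integrable (fun l : EuclideanSpace ℝ (Fin M) => l k ^ 2 * gd M τ l) :=
  .of_integral_ne_zero (by rw [gd_second M τ hτ k]; positivity)

lemma sd_eq (M : ℕ) (τ : ℝ) (R : ℝ≥0∞) (l) : sparsityDensity M τ R l
    = gd M τ l * (if ENNReal.ofReal ‖l‖ ≤ R then 1 else 0) := by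
  unfold sparsityDensity gd; split_ifs <;> simp

lemma sd_nonneg (M : ℕ) (τ : ℝ) (hτ : 0 < τ) (R : ℝ≥0∞) (l) : 0 ≤ sparsityDensity M τ R l := by
  rw [sd_eq]; have := gd_pos M τ hτ l; split_ifs <;> simp [this.le]

lemma sd_le (M : ℕ) (τ : ℝ) (hτ : 0 < τ) (R : ℝ≥0∞) (l) : sparsityDensity M τ R l ≤ gd M τ l := by
  rw [sd_eq]; have := gd_pos M τ hτ l; split_ifs <;> simp [this.le]

lemma sd_meas (M : ℕ) (τ : ℝ) (R : ℝ≥0∞) : Measurable (sparsityDensity M τ R) := by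
  have : sparsityDensity M τ R = fun l => gd M τ l * (if ENNReal.ofReal ‖l‖ ≤ R then 1 else 0) :=
    funext (sd_eq M τ R)
  rw [this]
  refine (gd_cont M τ).measurable.mul (Measurable.ite ?_ measurable_const measurable_const)
  exact measurableSet_le (by fun_prop) measurable_const

lemma sd_integrable (M : ℕ) (τ : ℝ) (hτ : 0 < τ) (R : ℝ≥0∞) :
    Integrable (sparsityDensity M τ R) := by
  refine (gd_integrable M τ hτ).mono' (sd_meas M τ R).aestronglyMeasurable
    (Filter.Eventually.of_forall fun l => ?_)
  rw [Real.norm_of_nonneg (sd_nonneg M τ hτ R l)]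
  exact sd_le M τ hτ R l

lemma sd_sq_integrable (M : ℕ) (τ : ℝ) (hτ : 0 < τ) (R : ℝ≥0∞) (k : Fin M) :
    Integrable (fun l => l k ^ 2 * sparsityDensity M τ R l) := by
  have := sd_meas M τ R
  refine (gd_second_integrable M τ hτ k).mono' (by fun_prop)
    (Filter.Eventually.of_forall fun l => ?_)
  rw [Real.norm_of_nonneg (mul_nonneg (sq_nonneg _) (sd_nonneg M τ hτ R l))]
  exact mul_le_mul_of_nonneg_left (sd_le M τ hτ R l) (sq_nonneg _)

lemma sd_cross_integrable (M : ℕ) (τ : ℝ) (hτ : 0 < τ) (R : ℝ≥0∞) (j k : Fin M) :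
    Integrable (fun l => l j * l k * sparsityDensity M τ R l) := by
  have := sd_meas M τ R
  refine ((sd_sq_integrable M τ hτ R j).add (sd_sq_integrable M τ hτ R k)).mono' (by fun_prop)
    (Filter.Eventually.of_forall fun l => ?_)
  have h := sd_nonneg M τ hτ R l
  rw [norm_mul, Real.norm_of_nonneg h, norm_mul, Pi.add_apply, ← add_mul]
  refine mul_le_mul_of_nonneg_right ?_ h
  simp only [Real.norm_eq_abs]
  rw [← sq_abs (l j), ← sq_abs (l k)]
  nlinarith [sq_nonneg (|l j| - |l k|), sq_nonneg (|l j|), sq_nonneg (|l k|)]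

lemma sd_lin_integrable (M : ℕ) (τ : ℝ) (hτ : 0 < τ) (R : ℝ≥0∞) (k : Fin M) :
    Integrable (fun l => l k * sparsityDensity M τ R l) := by
  have := sd_meas M τ R
  refine ((sd_integrable M τ hτ R).add (sd_sq_integrable M τ hτ R k)).mono' (by fun_prop)
    (Filter.Eventually.of_forall fun l => ?_)
  have h := sd_nonneg M τ hτ R l
  rw [norm_mul, Real.norm_of_nonneg h, Pi.add_apply, ← one_add_mul]
  refine mul_le_mul_of_nonneg_right ?_ h
  simp only [Real.norm_eq_abs]
  rw [← sq_abs (l k)]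
  nlinarith [sq_nonneg (|l k| - 1), sq_nonneg (|l k|)]

lemma sd_sq_le (M : ℕ) (τ : ℝ) (hτ : 0 < τ) (R : ℝ≥0∞) (k : Fin M) :
    ∫ l, l k ^ 2 * sparsityDensity M τ R l ≤ τ ^ 2 := by
  rw [← gd_second M τ hτ k]
  exact integral_mono (sd_sq_integrable M τ hτ R k) (gd_second_integrable M τ hτ k)
    fun l => mul_le_mul_of_nonneg_left (sd_le M τ hτ R l) (sq_nonneg _)

/-- coordinate reflection -/
def reflK (M : ℕ) (k : Fin M) : EuclideanSpace ℝ (Fin M) ≃ₗᵢ[ℝ] EuclideanSpace ℝ (Fin M) :=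
  LinearIsometryEquiv.piLpCongrRight 2
    (fun i => if i = k then LinearIsometryEquiv.neg ℝ else LinearIsometryEquiv.refl ℝ ℝ)

lemma reflK_apply (M : ℕ) (k i : Fin M) (l) : reflK M k l i = if i = k then - l i else l i := by
  simp only [reflK, LinearIsometryEquiv.piLpCongrRight_apply]
  split_ifs <;> simp_all

lemma sd_refl (M : ℕ) (τ : ℝ) (R : ℝ≥0∞) (k : Fin M) (l) :
    sparsityDensity M τ R (reflK M k l) = sparsityDensity M τ R l := by
  rw [sd_eq, sd_eq, LinearIsometryEquiv.norm_map]
  congr 1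
  unfold gd
  refine Finset.prod_congr rfl fun j _ => ?_
  rw [reflK_apply]
  split_ifs
  · simp [q0, neg_div, abs_neg]
  · rfl

lemma odd_zero (M : ℕ) (k : Fin M) (h : EuclideanSpace ℝ (Fin M) → ℝ)
    (hh : ∀ l, h (reflK M k l) = - h l) : ∫ l, h l = 0 := by
  have := (reflK M k).measurePreserving.integral_comp
    (reflK M k).toHomeomorph.measurableEmbedding h
  simp only [hh, integral_neg] at this
  linarith

lemma sd_lin_zero (M : ℕ) (τ : ℝ) (R : ℝ≥0∞) (k : Fin M) :
    ∫ l, l k * sparsityDensity M τ R l = 0 := by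
  apply odd_zero M k
  intro l
  rw [sd_refl, reflK_apply]; simp

lemma sd_cross_zero (M : ℕ) (τ : ℝ) (R : ℝ≥0∞) (j k : Fin M) (hjk : j ≠ k) :
    ∫ l, l j * l k * sparsityDensity M τ R l = 0 := by
  apply odd_zero M k
  intro l
  rw [sd_refl, reflK_apply, reflK_apply]; simp [hjk]

lemma sd_mono (M : ℕ) (τ : ℝ) (hτ : 0 < τ) (R S : ℝ≥0∞) (h : R ≤ S) (l) :
    sparsityDensity M τ R l ≤ sparsityDensity M τ S l := by
  rw [sd_eq, sd_eq]
  refine mul_le_mul_of_nonneg_left ?_ (gd_pos M τ hτ l).le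
  split_ifs with h1 h2 <;> norm_num
  exact h2 (h1.trans h)

lemma C_mono (M : ℕ) (τ : ℝ) (hτ : 0 < τ) (R S : ℝ≥0∞) (h : R ≤ S) :
    ∫ l, sparsityDensity M τ R l ≤ ∫ l, sparsityDensity M τ S l :=
  integral_mono (sd_integrable M τ hτ R) (sd_integrable M τ hτ S) (sd_mono M τ hτ R S h)

lemma C_top (M : ℕ) (τ : ℝ) (hτ : 0 < τ) : ∫ l, sparsityDensity M τ ⊤ l = 1 := by
  rw [← gd_integral M τ hτ]; simp [sd_eq]

lemma C_lower (M : ℕ) (τ : ℝ) (hτ : 0 < τ) (R a : ℝ) (ha : 0 ≤ a)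
    (haR : a * τ * √M ≤ R) :
    (1 - ((1 + a) ^ 3)⁻¹) ^ M ≤ ∫ l, sparsityDensity M τ (ENNReal.ofReal R) l := by
  have e := eucl_prod_integral M (fun _ t => if |t| ≤ a * τ then τ⁻¹ * q0 (t / τ) else 0)
  simp only [d_cut τ hτ a ha, Finset.prod_const, Finset.card_univ, Fintype.card_fin] at e
  rw [← e]
  refine integral_mono_of_nonneg (Filter.Eventually.of_forall fun l => ?_)
    (sd_integrable M τ hτ _) (Filter.Eventually.of_forall fun l => ?_)
  · refine Finset.prod_nonneg fun j _ => ?_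
    have := q0_pos (l j / τ)
    split_ifs <;> positivity
  · by_cases hl : ∀ j, |l j| ≤ a * τ
    · have hn : ‖l‖ ≤ R := by
        refine le_trans ?_ haR
        rw [EuclideanSpace.norm_eq]
        have h0 : 0 ≤ a * τ := by positivity
        rw [show a * τ * √M = √((a * τ) ^ 2 * M) by
          rw [Real.sqrt_mul (by positivity), Real.sqrt_sq h0]]
        apply Real.sqrt_le_sqrt
        calc ∑ i, ‖l i‖ ^ 2 ≤ ∑ i : Fin M, (a * τ) ^ 2 :=
              Finset.sum_le_sum fun i _ => pow_le_pow_left₀ (norm_nonneg _) (hl i) 2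
          _ = _ := by simp; ring
      have : ENNReal.ofReal ‖l‖ ≤ ENNReal.ofReal R := ENNReal.ofReal_le_ofReal hn
      rw [sd_eq, if_pos this]
      simp [hl, gd]
    · push Not at hl
      obtain ⟨j, hj⟩ := hl
      simp only
      rw [Finset.prod_eq_zero (Finset.mem_univ j) (if_neg (not_le.2 hj))]
      exact sd_nonneg M τ hτ _ l

lemma quad_expand (M : ℕ) (a s : ℝ) (b u : Fin M → ℝ) :
    (a + ∑ j, u j * b j) ^ 2 * s = a ^ 2 * s + ∑ j, (2 * a * b j) * (u j * s)
      + ∑ j, ∑ k, (b j * b k) * (u j * u k * s) := by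
  have h : (∑ j, u j * b j) ^ 2 = ∑ j, ∑ k, (b j * b k) * (u j * u k) := by
    rw [pow_two, Finset.sum_mul_sum]
    refine Finset.sum_congr rfl fun j _ => Finset.sum_congr rfl fun k _ => by ring
  rw [add_sq, h, add_mul, add_mul, Finset.mul_sum, Finset.sum_mul, Finset.sum_mul]
  congr 1
  · congr 1
    refine Finset.sum_congr rfl fun j _ => by ring
  · refine Finset.sum_congr rfl fun j _ => ?_
    rw [Finset.sum_mul]
    refine Finset.sum_congr rfl fun k _ => by ring

lemma quad_integrable (M : ℕ) (τ : ℝ) (hτ : 0 < τ) (R : ℝ≥0∞) (a : ℝ) (b : Fin M → ℝ) :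
    Integrable (fun u : EuclideanSpace ℝ (Fin M) =>
      (a + ∑ j, u j * b j) ^ 2 * sparsityDensity M τ R u) := by
  simp only [quad_expand]
  refine Integrable.add (Integrable.add ?_ ?_) ?_
  · exact (sd_integrable M τ hτ R).const_mul _
  · exact integrable_finsetSum _ fun j _ => (sd_lin_integrable M τ hτ R j).const_mul _
  · exact integrable_finsetSum _ fun j _ => integrable_finsetSum _ fun k _ =>
      (sd_cross_integrable M τ hτ R j k).const_mul _

lemma quad_integral (M : ℕ) (τ : ℝ) (hτ : 0 < τ) (R : ℝ≥0∞) (a : ℝ) (b : Fin M → ℝ) :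
    ∫ u : EuclideanSpace ℝ (Fin M), (a + ∑ j, u j * b j) ^ 2 * sparsityDensity M τ R u
      ≤ a ^ 2 * (∫ u, sparsityDensity M τ R u) + τ ^ 2 * ∑ j, b j ^ 2 := by
  simp only [quad_expand]
  have i1 : Integrable (fun u => a ^ 2 * sparsityDensity M τ R u) :=
    (sd_integrable M τ hτ R).const_mul _
  have i2 : Integrable (fun u : EuclideanSpace ℝ (Fin M) =>
      ∑ j, (2 * a * b j) * (u j * sparsityDensity M τ R u)) :=
    integrable_finsetSum _ fun j _ => (sd_lin_integrable M τ hτ R j).const_mul _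
  have i3 : ∀ j, Integrable (fun u : EuclideanSpace ℝ (Fin M) =>
      ∑ k, (b j * b k) * (u j * u k * sparsityDensity M τ R u)) := fun j =>
    integrable_finsetSum _ fun k _ => (sd_cross_integrable M τ hτ R j k).const_mul _
  have i12 : Integrable (fun u : EuclideanSpace ℝ (Fin M) => a ^ 2 * sparsityDensity M τ R u +
      ∑ j, (2 * a * b j) * (u j * sparsityDensity M τ R u)) := i1.add i2
  rw [integral_add i12 (integrable_finsetSum _ fun j _ => i3 j), integral_add i1 i2,
    integral_const_mul, integral_finsetSum _
      (fun j _ => (sd_lin_integrable M τ hτ R j).const_mul _),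
    integral_finsetSum _ (fun j _ => i3 j)]
  simp only [integral_const_mul, sd_lin_zero, mul_zero, Finset.sum_const_zero, add_zero]
  gcongr
  rw [Finset.mul_sum]
  refine Finset.sum_le_sum fun j _ => ?_
  rw [integral_finsetSum _ (fun k _ => (sd_cross_integrable M τ hτ R j k).const_mul _)]
  rw [Finset.sum_eq_single j]
  · rw [integral_const_mul]
    have := sd_sq_le M τ hτ R j
    simp only [← pow_two]
    rw [mul_comm]
    exact mul_le_mul_of_nonneg_right this (sq_nonneg _)
  · intro k _ hk
    rw [integral_const_mul, sd_cross_zero M τ R j k hk.symm, mul_zero]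
  · simp

lemma normSqV_nonneg (n : ℕ) (v) : 0 ≤ normSqV n v := by unfold normSqV; positivity

lemma risk_int (n M : ℕ) (τ : ℝ) (hτ : 0 < τ) (R : ℝ≥0∞) (A : Fin n → ℝ)
    (B : Fin M → Fin n → ℝ) (hC : 0 < ∫ u, sparsityDensity M τ R u) :
    ∫⁻ u : EuclideanSpace ℝ (Fin M), ENNReal.ofReal ((∫ u, sparsityDensity M τ R u)⁻¹ *
        sparsityDensity M τ R u) * ENNReal.ofReal (normSqV n fun i => A i + ∑ j, u j * B j i)
      ≤ ENNReal.ofReal (normSqV n A +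
        (∫ u, sparsityDensity M τ R u)⁻¹ * τ ^ 2 * ∑ j, normSqV n (B j)) := by
  set C := ∫ u, sparsityDensity M τ R u
  have e : ∀ u : EuclideanSpace ℝ (Fin M), ENNReal.ofReal (C⁻¹ * sparsityDensity M τ R u) *
      ENNReal.ofReal (normSqV n fun i => A i + ∑ j, u j * B j i)
      = ENNReal.ofReal (C⁻¹ * (n : ℝ)⁻¹ *
        ∑ i, (A i + ∑ j, u j * B j i) ^ 2 * sparsityDensity M τ R u) := by
    intro u
    rw [← ENNReal.ofReal_mul (mul_nonneg (inv_nonneg.2 hC.le) (sd_nonneg M τ hτ R u))]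
    congr 1
    rw [← Finset.sum_mul, normSqV]
    ring
  simp only [e]
  have hI : Integrable (fun u : EuclideanSpace ℝ (Fin M) => C⁻¹ * (n : ℝ)⁻¹ *
        ∑ i, (A i + ∑ j, u j * B j i) ^ 2 * sparsityDensity M τ R u) :=
    (integrable_finsetSum _ fun i _ =>
      quad_integrable M τ hτ R (A i) (fun j => B j i)).const_mul _
  rw [← ofReal_integral_eq_lintegral_ofReal hI]
  · apply ENNReal.ofReal_le_ofReal
    rw [integral_const_mul, integral_finsetSum _ (fun i _ =>
      quad_integrable M τ hτ R (A i) (fun j => B j i))]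
    calc C⁻¹ * (n : ℝ)⁻¹ * ∑ i, ∫ u : EuclideanSpace ℝ (Fin M),
          (A i + ∑ j, u j * B j i) ^ 2 * sparsityDensity M τ R u
        ≤ C⁻¹ * (n : ℝ)⁻¹ * ∑ i, (A i ^ 2 * C + τ ^ 2 * ∑ j, B j i ^ 2) := by
          gcongr with i
          exact quad_integral M τ hτ R (A i) (fun j => B j i)
      _ = _ := by
          rw [Finset.sum_add_distrib, ← Finset.sum_mul, ← Finset.mul_sum, Finset.sum_comm]
          simp only [normSqV, ← Finset.sum_div]
          field_simp
  · refine Filter.Eventually.of_forall fun u => ?_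
    exact mul_nonneg (mul_nonneg (inv_nonneg.2 hC.le) (inv_nonneg.2 (Nat.cast_nonneg n)))
      (Finset.sum_nonneg fun i _ => mul_nonneg (sq_nonneg _) (sd_nonneg M τ hτ R u))

/-- the shifted measure -/
def pm (M : ℕ) (τ : ℝ) (R : ℝ≥0∞) (ls : EuclideanSpace ℝ (Fin M)) :
    Measure (EuclideanSpace ℝ (Fin M)) :=
  volume.withDensity fun l =>
    ENNReal.ofReal ((∫ l', sparsityDensity M τ R l')⁻¹ * sparsityDensity M τ R (l - ls))

lemma pm_meas (M : ℕ) (τ : ℝ) (R : ℝ≥0∞) (ls : EuclideanSpace ℝ (Fin M)) :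
    Measurable fun l => ENNReal.ofReal
      ((∫ l', sparsityDensity M τ R l')⁻¹ * sparsityDensity M τ R (l - ls)) := by
  have := sd_meas M τ R
  fun_prop

lemma pm_prob (M : ℕ) (τ : ℝ) (hτ : 0 < τ) (R : ℝ≥0∞) (ls : EuclideanSpace ℝ (Fin M))
    (hC : 0 < ∫ u, sparsityDensity M τ R u) : IsProbabilityMeasure (pm M τ R ls) := by
  constructor
  rw [pm, withDensity_apply _ MeasurableSet.univ, Measure.restrict_univ]
  rw [lintegral_sub_right_eq_self (fun l => ENNReal.ofReal
      ((∫ l', sparsityDensity M τ R l')⁻¹ * sparsityDensity M τ R l)) ls]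
  rw [← ofReal_integral_eq_lintegral_ofReal ((sd_integrable M τ hτ R).const_mul _)]
  · rw [integral_const_mul, inv_mul_cancel₀ hC.ne', ENNReal.ofReal_one]
  · exact Filter.Eventually.of_forall fun u =>
      mul_nonneg (inv_nonneg.2 hC.le) (sd_nonneg M τ hτ R u)

lemma pm_ae (M : ℕ) (τ : ℝ) (R : ℝ≥0∞) (ls : EuclideanSpace ℝ (Fin M)) :
    ∀ᵐ l ∂(pm M τ R ls), ENNReal.ofReal ‖l - ls‖ ≤ R := by
  rw [pm, ae_withDensity_iff (pm_meas M τ R ls)]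
  refine Filter.Eventually.of_forall fun l h => ?_
  by_contra hc
  apply h
  rw [sd_eq, if_neg hc]; simp

lemma pm_risk (n M : ℕ) (τ : ℝ) (hτ : 0 < τ) (R : ℝ≥0∞) (ls : EuclideanSpace ℝ (Fin M))
    (F : Fin n → ℝ) (B : Fin M → Fin n → ℝ) (hC : 0 < ∫ u, sparsityDensity M τ R u) :
    ∫⁻ l, ENNReal.ofReal (normSqV n fun i => (∑ j, l j * B j i) - F i) ∂(pm M τ R ls)
      ≤ ENNReal.ofReal ((normSqV n fun i => (∑ j, ls j * B j i) - F i) +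
        (∫ u, sparsityDensity M τ R u)⁻¹ * τ ^ 2 * ∑ j, normSqV n (B j)) := by
  have hm : Measurable fun l : EuclideanSpace ℝ (Fin M) =>
      ENNReal.ofReal (normSqV n fun i => (∑ j, l j * B j i) - F i) := by
    unfold normSqV; fun_prop
  rw [pm, lintegral_withDensity_eq_lintegral_mul _ (pm_meas M τ R ls) hm]
  refine le_trans (le_of_eq ?_) (risk_int n M τ hτ R _ B hC)
  refine Eq.trans ?_ (lintegral_sub_right_eq_self _ ls)
  refine lintegral_congr fun l => ?_
  simp only [Pi.mul_apply]
  congr 3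
  ext i
  simp only [PiLp.sub_apply, sub_mul, Finset.sum_sub_distrib]
  ring

lemma q0_ratio (a b : ℝ) : q0 a ≤ q0 b * (1 + |b - a|) ^ 4 := by
  unfold q0
  have h : 1 + |b| ≤ (1 + |a|) * (1 + |b - a|) := by
    have := abs_add_le a (b - a)
    rw [add_sub_cancel] at this
    nlinarith [abs_nonneg a, abs_nonneg (b - a), mul_nonneg (abs_nonneg a) (abs_nonneg (b - a))]
  have h4 : (1 + |b|) ^ 4 ≤ ((1 + |a|) * (1 + |b - a|)) ^ 4 :=
    pow_le_pow_left₀ (by positivity) h 4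
  rw [div_mul_eq_mul_div, div_le_div_iff₀ (by positivity) (by positivity)]
  rw [mul_pow] at h4
  nlinarith

lemma gd_ratio (M : ℕ) (τ : ℝ) (hτ : 0 < τ) (u v : EuclideanSpace ℝ (Fin M)) :
    Real.log (gd M τ u / gd M τ v) ≤ 4 * ∑ j, Real.log (1 + τ⁻¹ * |v j - u j|) := by
  have h : gd M τ u ≤ gd M τ v * ∏ j, (1 + τ⁻¹ * |v j - u j|) ^ 4 := by
    unfold gd
    rw [← Finset.prod_mul_distrib]
    refine Finset.prod_le_prod (fun j _ => ?_) fun j _ => ?_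
    · have := q0_pos (u j / τ); positivity
    · rw [mul_assoc]
      have := q0_ratio (u j / τ) (v j / τ)
      rw [← sub_div, abs_div, abs_of_pos hτ, div_eq_inv_mul |v j - u j|] at this
      exact mul_le_mul_of_nonneg_left this (by positivity)
  have h1 : gd M τ u / gd M τ v ≤ ∏ j, (1 + τ⁻¹ * |v j - u j|) ^ 4 := by
    rw [div_le_iff₀ (gd_pos M τ hτ v), mul_comm]; exact h
  refine (Real.log_le_log (div_pos (gd_pos M τ hτ u) (gd_pos M τ hτ v)) h1).trans (le_of_eq ?_)
  rw [Real.log_prod (fun j _ => by positivity), Finset.mul_sum]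
  refine Finset.sum_congr rfl fun j _ => ?_
  rw [Real.log_pow]; norm_num

lemma kl_bound (M : ℕ) (τ : ℝ) (hτ : 0 < τ) (R L : ℝ≥0∞) (ls : EuclideanSpace ℝ (Fin M))
    (hC : 0 < ∫ u, sparsityDensity M τ R u) (hL : 0 < ∫ u, sparsityDensity M τ L u)
    (hsub : ∀ l : EuclideanSpace ℝ (Fin M), ENNReal.ofReal ‖l - ls‖ ≤ R → ENNReal.ofReal ‖l‖ ≤ L) :
    ∃ K : ℝ, klDiv (pm M τ R ls) (sparsityPrior M τ L) = K ∧
      K ≤ Real.log ((∫ u, sparsityDensity M τ L u) / (∫ u, sparsityDensity M τ R u))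
        + 4 * ∑ j, Real.log (1 + τ⁻¹ * |ls j|) := by
  have hprob := pm_prob M τ hτ R ls hC
  have hpi : sparsityPrior M τ L = pm M τ L 0 := by simp [sparsityPrior, pm]
  have hprob2 := pm_prob M τ hτ L 0 hL
  rw [hpi]
  set CL := ∫ u, sparsityDensity M τ L u with hCL
  set CR := ∫ u, sparsityDensity M τ R u with hCR
  set D : EuclideanSpace ℝ (Fin M) → ℝ≥0∞ := fun l => ENNReal.ofReal
    ((CL / CR) * (sparsityDensity M τ R (l - ls) / gd M τ l)) with hD
  have hDm : Measurable D := by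
    have := sd_meas M τ R
    have := (gd_cont M τ).measurable
    fun_prop
  have hpD : pm M τ R ls = (pm M τ L 0).withDensity D := by
    conv_rhs => rw [pm]
    rw [← withDensity_mul _ (pm_meas M τ L 0) hDm, pm]
    congr 1
    ext l
    rw [Pi.mul_apply, hD, ← ENNReal.ofReal_mul
      (mul_nonneg (inv_nonneg.2 hL.le) (sd_nonneg M τ hτ L _))]
    congr 1
    rw [← hCR, sub_zero]
    have hg := (gd_pos M τ hτ l).ne'
    by_cases h : ENNReal.ofReal ‖l - ls‖ ≤ R
    · rw [sd_eq M τ L l, if_pos (hsub l h)]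
      field_simp
    · rw [sd_eq M τ R, if_neg h]; simp
  have hac : pm M τ R ls ≪ pm M τ L 0 := by
    rw [hpD]; exact withDensity_absolutelyContinuous _ _
  have hrn : (pm M τ R ls).rnDeriv (pm M τ L 0) =ᵐ[pm M τ R ls] D := by
    apply hac.ae_eq
    have := Measure.rnDeriv_withDensity (pm M τ L 0) hDm
    rwa [← hpD] at this
  set S := 4 * ∑ j, Real.log (1 + τ⁻¹ * |ls j|) with hS
  have hae : ∀ᵐ l ∂(pm M τ R ls),
      |Real.log ((pm M τ R ls).rnDeriv (pm M τ L 0) l).toReal - Real.log (CL / CR)| ≤ S := by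
    filter_upwards [hrn, pm_ae M τ R ls] with l h1 h2
    have hg := gd_pos M τ hτ l
    have hg2 := gd_pos M τ hτ (l - ls)
    rw [h1, hD]
    simp only
    rw [sd_eq, if_pos h2, mul_one, ENNReal.toReal_ofReal (by positivity),
      Real.log_mul (by positivity) (by positivity), add_sub_cancel_left, abs_le]
    constructor
    · have := gd_ratio M τ hτ l (l - ls)
      rw [← inv_div, Real.log_inv]
      simp only [PiLp.sub_apply, sub_sub_cancel_left, abs_neg] at this
      linarith
    · have := gd_ratio M τ hτ (l - ls) l
      simpa using this
  have hint : Integrable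
      (fun a => Real.log ((pm M τ R ls).rnDeriv (pm M τ L 0) a).toReal) (pm M τ R ls) := by
    refine Integrable.of_bound (C := |Real.log (CL / CR)| + S) ?_ ?_
    · exact ((Measure.measurable_rnDeriv _ _).ennreal_toReal.log).aestronglyMeasurable
    · filter_upwards [hae] with l hl
      rw [Real.norm_eq_abs]
      have := abs_sub_abs_le_abs_sub
        (Real.log ((pm M τ R ls).rnDeriv (pm M τ L 0) l).toReal) (Real.log (CL / CR))
      linarith
  refine ⟨∫ a, Real.log ((pm M τ R ls).rnDeriv (pm M τ L 0) a).toReal ∂(pm M τ R ls), ?_, ?_⟩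
  · rw [_root_.klDiv, if_pos ⟨hac, hint⟩]
  · calc _ ≤ ∫ _, (Real.log (CL / CR) + S) ∂(pm M τ R ls) := by
          refine integral_mono_ae hint (integrable_const _) ?_
          filter_upwards [hae] with l hl
          have := (abs_le.1 hl).2
          linarith
      _ = _ := by simp

open Classical in
/-- Theorem 5 of the paper: any estimator satisfying the PAC-Bayesian bound with the
sparsity prior satisfies a sparsity oracle inequality. -/
theorem soi_from_pac_bayes
    {X : Type*} (n M : ℕ) (hn : 0 < n) (hM : 0 < M)
    (x : Fin n → X) (f : X → ℝ) (φ : Fin M → X → ℝ)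
    (Λ : Set (EuclideanSpace ℝ (Fin M)))
    (τ δ : ℝ) (hτ : 0 < τ) (hδ0 : 0 < δ) (hδ1 : δ < 1)
    (L₀ : ℝ≥0∞) (hL₀ : 0 < L₀)
    -- τ ≤ δL₀/√M
    (hτL : ENNReal.ofReal (τ * Real.sqrt M) ≤ ENNReal.ofReal δ * L₀)
    -- Λ contains the ball of radius L₀
    (hball : {l : EuclideanSpace ℝ (Fin M) | ENNReal.ofReal ‖l‖ ≤ L₀} ⊆ Λ)
    (β : ℝ) (hβ : 0 < β)
    -- `risk` is the expected risk E‖f̂ₙ − f‖ₙ² of an estimator satisfying the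
    -- PAC-Bayesian bound (6) with the sparsity prior
    (risk : ℝ≥0∞)
    (hPAC : ∀ p : Measure (EuclideanSpace ℝ (Fin M)),
      IsProbabilityMeasure p → p Λ = 1 →
      (risk : EReal)
        ≤ ((∫⁻ l, ENNReal.ofReal (normSqV n fun i =>
              (∑ j, l j * φ j (x i)) - f (x i)) ∂p : ℝ≥0∞) : EReal)
          + ((β / n : ℝ) : EReal) * klDiv p (sparsityPrior M τ L₀)) :
    ∀ lstar : EuclideanSpace ℝ (Fin M),
      ENNReal.ofReal ‖lstar‖ ≤ ENNReal.ofReal (1 - δ) * L₀ →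
      risk ≤ ENNReal.ofReal
        ((normSqV n fun i => (∑ j, lstar j * φ j (x i)) - f (x i))
          + (4 * β / n) * (∑ j ∈ Finset.univ.filter (fun j => lstar j ≠ 0),
              Real.log (1 + τ⁻¹ * |lstar j|))
          + (if L₀ = ⊤ then τ ^ 2 * ∑ j, normSqV n fun i => φ j (x i)
             else τ ^ 2 * Real.exp (2 * τ ^ 3 * (M : ℝ) ^ ((5 : ℝ) / 2)
                    / (δ * L₀.toReal) ^ 3) * (∑ j, normSqV n fun i => φ j (x i))
                  + 2 * β * τ ^ 3 * (M : ℝ) ^ ((5 : ℝ) / 2)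
                    / (n * δ ^ 3 * L₀.toReal ^ 3))) := by
  intro ls hls
  have hsub : ∀ l : EuclideanSpace ℝ (Fin M),
      ENNReal.ofReal ‖l - ls‖ ≤ ENNReal.ofReal δ * L₀ → ENNReal.ofReal ‖l‖ ≤ L₀ := by
    intro l hl
    calc ENNReal.ofReal ‖l‖ ≤ ENNReal.ofReal (‖l - ls‖ + ‖ls‖) := by
          apply ENNReal.ofReal_le_ofReal
          simpa using norm_add_le (l - ls) ls
      _ = ENNReal.ofReal ‖l - ls‖ + ENNReal.ofReal ‖ls‖ :=
          ENNReal.ofReal_add (norm_nonneg _) (norm_nonneg _)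
      _ ≤ ENNReal.ofReal δ * L₀ + ENNReal.ofReal (1 - δ) * L₀ := add_le_add hl hls
      _ = L₀ := by
          rw [← add_mul, ← ENNReal.ofReal_add hδ0.le (by linarith)]
          simp
  have hRL : ENNReal.ofReal δ * L₀ ≤ L₀ := by
    calc ENNReal.ofReal δ * L₀ ≤ 1 * L₀ := by
          gcongr
          exact ENNReal.ofReal_le_one.2 hδ1.le
      _ = L₀ := one_mul _
  have hsum : ∑ j ∈ Finset.univ.filter (fun j => ls j ≠ 0), Real.log (1 + τ⁻¹ * |ls j|)
      = ∑ j, Real.log (1 + τ⁻¹ * |ls j|) := by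
    rw [Finset.sum_filter]
    refine Finset.sum_congr rfl fun j _ => ?_
    by_cases h : ls j = 0 <;> simp [h]
  rw [hsum]
  have gen : 0 < ∫ u, sparsityDensity M τ (ENNReal.ofReal δ * L₀) u → ∀ Q : ℝ,
      (∫ u, sparsityDensity M τ (ENNReal.ofReal δ * L₀) u)⁻¹ * τ ^ 2 *
        (∑ j, normSqV n fun i => φ j (x i)) + β / n * Real.log
          ((∫ u, sparsityDensity M τ L₀ u) / ∫ u, sparsityDensity M τ (ENNReal.ofReal δ * L₀) u)
        ≤ Q →
      risk ≤ ENNReal.ofReal ((normSqV n fun i => (∑ j, ls j * φ j (x i)) - f (x i))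
          + (4 * β / n) * (∑ j, Real.log (1 + τ⁻¹ * |ls j|)) + Q) := by
    intro hC Q hQ
    have hL := hC.trans_le (C_mono M τ hτ _ _ hRL)
    have hprob := pm_prob M τ hτ _ ls hC
    have hΛ : pm M τ (ENNReal.ofReal δ * L₀) ls Λ = 1 := by
      refine le_antisymm prob_le_one ?_
      rw [← measure_univ (μ := pm M τ (ENNReal.ofReal δ * L₀) ls)]
      refine measure_mono_ae ?_
      filter_upwards [pm_ae M τ (ENNReal.ofReal δ * L₀) ls] with l hl _
      exact hball (hsub l hl)
    have h1 := hPAC _ hprob hΛ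
    have h2 := pm_risk n M τ hτ _ ls (fun i => f (x i)) (fun j i => φ j (x i)) hC
    obtain ⟨K, hK, hKle⟩ := kl_bound M τ hτ _ L₀ ls hC hL hsub
    rw [hK] at h1
    rw [← EReal.coe_ennreal_le_coe_ennreal_iff]
    refine h1.trans ((add_le_add_left (EReal.coe_ennreal_le_coe_ennreal_iff.2 h2) _).trans ?_)
    rw [EReal.coe_ennreal_ofReal, EReal.coe_ennreal_ofReal, max_eq_left, ← EReal.coe_mul,
      ← EReal.coe_add, EReal.coe_le_coe_iff]
    · refine le_trans ?_ (le_max_left _ _)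
      have hb : 0 ≤ β / n := by positivity
      have := mul_le_mul_of_nonneg_left hKle hb
      have e : 4 * β / n * ∑ j, Real.log (1 + τ⁻¹ * |ls j|)
        = β / n * (4 * ∑ j, Real.log (1 + τ⁻¹ * |ls j|)) := by ring
      rw [e]
      linarith
    · refine add_nonneg (normSqV_nonneg _ _) (mul_nonneg
        (mul_nonneg (inv_nonneg.2 hC.le) (sq_nonneg _))
        (Finset.sum_nonneg fun j _ => normSqV_nonneg _ _))
  have hΦ : 0 ≤ ∑ j, normSqV n fun i => φ j (x i) :=
    Finset.sum_nonneg fun j _ => normSqV_nonneg _ _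
  by_cases hT : L₀ = ⊤
  · have hR : ENNReal.ofReal δ * L₀ = ⊤ := by
      rw [hT]; exact ENNReal.mul_top (by simpa using hδ0)
    rw [if_pos hT]
    apply gen
    · rw [hR, C_top M τ hτ]; norm_num
    · rw [hR, hT, C_top M τ hτ]; simp
  · rw [if_neg hT]
    set L := L₀.toReal with hLdef
    have hLpos : 0 < L := ENNReal.toReal_pos hL₀.ne' hT
    have hLe : L₀ = ENNReal.ofReal L := (ENNReal.ofReal_toReal hT).symm
    have hR : ENNReal.ofReal δ * L₀ = ENNReal.ofReal (δ * L) := by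
      rw [hLe, ENNReal.ofReal_mul hδ0.le]
    have hMpos : (0 : ℝ) < M := by exact_mod_cast hM
    have hs : 0 < √(M : ℝ) := Real.sqrt_pos.2 hMpos
    have hs2 : √(M : ℝ) ^ 2 = M := Real.sq_sqrt hMpos.le
    have h52 : (M : ℝ) ^ ((5 : ℝ) / 2) = M * √(M : ℝ) ^ 3 := by
      have : (M : ℝ) ^ ((5 : ℝ) / 2) = √(M : ℝ) ^ 5 := by
        rw [Real.sqrt_eq_rpow, ← Real.rpow_natCast, ← Real.rpow_mul hMpos.le]
        norm_num
      rw [this]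
      nth_rewrite 2 [← hs2]
      ring
    have hτL' : τ * √(M : ℝ) ≤ δ * L := by
      rw [hR] at hτL
      exact (ENNReal.ofReal_le_ofReal_iff (by positivity)).1 hτL
    set y := 2 * τ ^ 3 * (M : ℝ) ^ ((5 : ℝ) / 2) / (δ * L) ^ 3 with hy
    set a := δ * L / (τ * √(M : ℝ)) with ha
    have ha1 : 1 ≤ a := by rw [ha, le_div_iff₀ (by positivity)]; linarith
    have hya : y = 2 * M * (a ^ 3)⁻¹ := by
      rw [hy, h52, ha]; field_simp
    have hlow := C_lower M τ hτ (δ * L) a (by linarith) (by rw [ha]; apply le_of_eq; field_simp)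
    rw [← hR] at hlow
    set u := ((1 + a) ^ 3)⁻¹ with hu
    have hu0 : 0 ≤ u := by positivity
    have hu2 : u ≤ 1 / 2 := by
      rw [hu, one_div]
      apply inv_anti₀ (by norm_num)
      nlinarith [pow_le_pow_left₀ (by norm_num) (by linarith : (2:ℝ) ≤ 1 + a) 3]
    have hua : u ≤ (a ^ 3)⁻¹ := by
      apply inv_anti₀ (by positivity)
      gcongr
      linarith
    have hexp : Real.exp (-(2 * u)) ≤ 1 - u := by
      rw [Real.exp_neg, inv_le_comm₀ (Real.exp_pos _) (by linarith)]
      refine le_trans ?_ (Real.add_one_le_exp (2 * u))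
      rw [inv_le_iff_one_le_mul₀ (by linarith)]
      nlinarith
    have hCR : Real.exp (-y) ≤ ∫ u, sparsityDensity M τ (ENNReal.ofReal δ * L₀) u := by
      refine le_trans ?_ hlow
      refine le_trans ?_ (pow_le_pow_left₀ (Real.exp_pos _).le hexp M)
      rw [← Real.exp_nat_mul, Real.exp_le_exp, hya]
      nlinarith
    have hCL : ∫ u, sparsityDensity M τ L₀ u ≤ 1 := by
      rw [← C_top M τ hτ]; exact C_mono M τ hτ _ _ le_top
    have hCRL := C_mono M τ hτ _ _ hRL
    set CR := ∫ u, sparsityDensity M τ (ENNReal.ofReal δ * L₀) u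
    set CL := ∫ u, sparsityDensity M τ L₀ u
    have hCRpos : 0 < CR := (Real.exp_pos _).trans_le hCR
    have hinv : CR⁻¹ ≤ Real.exp y := by
      rw [← neg_neg y, Real.exp_neg]
      exact inv_anti₀ (Real.exp_pos _) hCR
    apply gen hCRpos
    have hlog : Real.log (CL / CR) ≤ y := by
      rw [Real.log_le_iff_le_exp (div_pos (hCRpos.trans_le hCRL) hCRpos), div_eq_mul_inv]
      calc CL * CR⁻¹ ≤ 1 * CR⁻¹ := by gcongr
        _ ≤ Real.exp y := by rw [one_mul]; exact hinv
    have e2 : 2 * β * τ ^ 3 * (M : ℝ) ^ ((5 : ℝ) / 2) / (n * δ ^ 3 * L ^ 3) = β / n * y := by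
      have hn' : (0 : ℝ) < n := by exact_mod_cast hn
      rw [hy]; field_simp
    rw [e2, mul_comm (τ ^ 2) (Real.exp y)]
    gcongr
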